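/- Let (W,S) be a Coxeter system of finite rank, let I, J ⊆ S, and let w ∈ W have every element of I as a left ascent and every element of J as a right ascent. Then the presentation C = W_I w W_J is minimal if and only if |I| + |J| ≤ |I'| + |J'| for every other presentation C = W_{I'} w W_{J'} of the same double coset with the same w. -/

import Mathlib

open CoxeterSystem

variable {B : Type*} {W : Type*} [Group W]

/-- The standard parabolic subgroup `W_I` of a Coxeter system, generated by the
simple reflections indexed by `I`. -/
def CoxeterSystem.parabolic {M : CoxeterMatrix B} (cs : CoxeterSystem M W) (I : Set B) :
    Subgroup W :=
  Subgroup.closure (cs.simple '' I)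

/-- The parabolic double coset `W_I w W_J`. -/
def CoxeterSystem.doubleCoset {M : CoxeterMatrix B} (cs : CoxeterSystem M W) (I : Set B)
    (w : W) (J : Set B) : Set W :=
  {x | ∃ u ∈ cs.parabolic I, ∃ v ∈ cs.parabolic J, x = u * w * v}

/-- Two simple reflections are adjacent in the Coxeter graph if they are distinct and
do not commute. -/
def CoxeterSystem.adjacent {M : CoxeterMatrix B} (cs : CoxeterSystem M W) (s t : B) : Prop :=
  s ≠ t ∧ cs.simple s * cs.simple t ≠ cs.simple t * cs.simple s

/-- The connected component of `i` in the subgraph of the Coxeter graph induced by `I`. -/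
def CoxeterSystem.component {M : CoxeterMatrix B} (cs : CoxeterSystem M W) (I : Set B)
    (i : B) : Set B :=
  {j | Relation.ReflTransGen (fun a b => a ∈ I ∧ b ∈ I ∧ cs.adjacent a b) i j}

/-- A presentation `C = W_I w W_J` is minimal if `I` consists of left ascents of `w`, `J`
consists of right ascents of `w`, no connected component of `I` is contained in
`(w J w⁻¹) ∩ S`, and no connected component of `J` is contained in `(w⁻¹ I w) ∩ S`. -/
def CoxeterSystem.IsMinimalPresentation {M : CoxeterMatrix B} (cs : CoxeterSystem M W)
    (I : Set B) (w : W) (J : Set B) : Prop :=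
  (∀ s ∈ I, cs.length w < cs.length (cs.simple s * w)) ∧
  (∀ s ∈ J, cs.length w < cs.length (w * cs.simple s)) ∧
  (∀ i ∈ I, ¬ (cs.component I i ⊆ {s : B | ∃ t ∈ J, cs.simple s = w * cs.simple t * w⁻¹})) ∧
  (∀ j ∈ J, ¬ (cs.component J j ⊆ {s : B | ∃ t ∈ I, cs.simple s = w⁻¹ * cs.simple t * w}))

namespace CoxeterSystem

/-! ### The geometric representation -/

section Geometric

open Module Polynomial.Chebyshev

variable (M : CoxeterMatrix B)

/-- The Cartan coefficients `-2 cos (π / M i j)` of a Coxeter matrix. -/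
noncomputable def cartanCoeff (i j : B) : ℝ := -2 * Real.cos (Real.pi / M i j)

theorem cartanCoeff_self (i : B) : cartanCoeff M i i = 2 := by
  simp [cartanCoeff]

theorem cartanCoeff_comm (i j : B) : cartanCoeff M i j = cartanCoeff M j i := by
  simp [cartanCoeff, M.symmetric i j]

/-- The simple coroot attached to `i`, as a linear functional on the root space. -/
noncomputable def simpleCoroot (i : B) : Dual ℝ (B →₀ ℝ) :=
  Finsupp.linearCombination ℝ (cartanCoeff M i)

theorem simpleCoroot_single (i j : B) :
    simpleCoroot M i (Finsupp.single j 1) = cartanCoeff M i j := by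
  simp [simpleCoroot]

theorem simpleCoroot_single_self (i : B) : simpleCoroot M i (Finsupp.single i 1) = 2 := by
  rw [simpleCoroot_single, cartanCoeff_self]

/-- The reflection of the root space in the `i`-th simple root. -/
noncomputable def simpleReflection (i : B) : (B →₀ ℝ) ≃ₗ[ℝ] (B →₀ ℝ) :=
  reflection (simpleCoroot_single_self M i)

theorem simpleReflection_apply (i : B) (v : B →₀ ℝ) :
    simpleReflection M i v = v - simpleCoroot M i v • Finsupp.single i 1 :=
  reflection_apply _ _

theorem eval_S_two_mul_cos_of_even {h : ℕ} (hh : 2 ≤ h) :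
    (S ℝ ((h : ℤ) - 1)).eval (2 * Real.cos (2 * (Real.pi / (2 * h : ℕ)))) = 0 := by
  have h0 : (2 : ℝ) ≤ h := by exact_mod_cast hh
  have hθ : 2 * (Real.pi / (2 * h : ℕ)) = Real.pi / h := by push_cast; field_simp
  rw [hθ]
  have hs : Real.sin (Real.pi / h) ≠ 0 := by
    refine (Real.sin_pos_of_pos_of_lt_pi (by positivity) ?_).ne'
    rw [div_lt_iff₀ (by positivity)]
    nlinarith [Real.pi_pos]
  have := S_two_mul_real_cos (Real.pi / h) ((h : ℤ) - 1)
  have e : (((h : ℤ) - 1 : ℤ) + 1 : ℝ) * (Real.pi / h) = Real.pi := by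
    push_cast; field_simp; ring
  rw [e, Real.sin_pi] at this
  exact (mul_eq_zero.mp this).resolve_right hs

theorem eval_S_add_eval_S_two_mul_cos_of_odd {h : ℕ} (hh : 1 ≤ h) :
    (S ℝ (h : ℤ)).eval (2 * Real.cos (2 * (Real.pi / (2 * h + 1 : ℕ)))) +
      (S ℝ ((h : ℤ) - 1)).eval (2 * Real.cos (2 * (Real.pi / (2 * h + 1 : ℕ)))) = 0 := by
  have h0 : (1 : ℝ) ≤ h := by exact_mod_cast hh
  set θ := 2 * (Real.pi / (2 * h + 1 : ℕ)) with hθ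
  have hs : Real.sin θ ≠ 0 := by
    refine (Real.sin_pos_of_pos_of_lt_pi (by positivity) ?_).ne'
    rw [hθ, ← mul_div_assoc, div_lt_iff₀ (by positivity)]
    push_cast
    nlinarith [Real.pi_pos]
  have h1 := S_two_mul_real_cos θ (h : ℤ)
  have h2 := S_two_mul_real_cos θ ((h : ℤ) - 1)
  have e : (((h : ℤ) : ℝ) + 1) * θ = 2 * Real.pi - (((h : ℤ) - 1 : ℤ) + 1 : ℝ) * θ := by
    rw [hθ]; push_cast; field_simp; ring
  rw [e, Real.sin_two_pi_sub] at h1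
  have : ((S ℝ (h : ℤ)).eval (2 * Real.cos θ) + (S ℝ ((h : ℤ) - 1)).eval (2 * Real.cos θ)) *
      Real.sin θ = 0 := by rw [add_mul, h1, h2]; ring
  exact (mul_eq_zero.mp this).resolve_right hs

theorem isLiftable_simpleReflection : M.IsLiftable (simpleReflection M) := by
  intro i j
  rcases eq_or_ne i j with rfl | hij
  · rw [M.diagonal, pow_one]
    ext1 v
    exact involutive_reflection (simpleCoroot_single_self M i) v
  have hm1 := M.off_diagonal i j hij
  change M i j ≠ 1 at hm1
  have hgx := simpleCoroot_single M j i
  have hfy := simpleCoroot_single M i j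
  rw [cartanCoeff_comm] at hgx
  ext1 v
  rcases Nat.even_or_odd' (M i j) with ⟨h, hh | hh⟩
  · rcases Nat.lt_or_ge h 2 with h2 | h2
    · interval_cases h
      · simp [hh]
      · have hc : cartanCoeff M i j = 0 := by simp [cartanCoeff, hh]
        rw [hc] at hgx hfy
        rw [hh, mul_one, pow_two]
        simp only [LinearEquiv.mul_apply, simpleReflection_apply, map_sub, map_smul, hgx, hfy,
          simpleCoroot_single_self, LinearEquiv.coe_one, id]
        module
    · have ht : 2 * Real.cos (2 * (Real.pi / (2 * h : ℕ))) =
          simpleCoroot M i (Finsupp.single j 1) * simpleCoroot M j (Finsupp.single i 1) - 2 := by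
        rw [hgx, hfy, cartanCoeff, hh, Real.cos_two_mul]; ring
      have := reflection_mul_reflection_pow_apply (simpleCoroot_single_self M i)
        (simpleCoroot_single_self M j) (M i j) v _ ht
      have e1 : ((M i j : ℤ) - 2) / 2 = (h : ℤ) - 1 := by omega
      have e2 : ((M i j : ℤ) - 1) / 2 = (h : ℤ) - 1 := by omega
      rw [e1, e2, eval_S_two_mul_cos_of_even h2] at this
      simpa [simpleReflection] using this
  · have h1 : 1 ≤ h := by omega
    have ht : 2 * Real.cos (2 * (Real.pi / (2 * h + 1 : ℕ))) =
        simpleCoroot M i (Finsupp.single j 1) * simpleCoroot M j (Finsupp.single i 1) - 2 := by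
      rw [hgx, hfy, cartanCoeff, hh, Real.cos_two_mul]; ring
    have := reflection_mul_reflection_pow_apply (simpleCoroot_single_self M i)
      (simpleCoroot_single_self M j) (M i j) v _ ht
    have e1 : ((M i j : ℤ) - 2) / 2 = (h : ℤ) - 1 := by omega
    have e2 : ((M i j : ℤ) - 1) / 2 = (h : ℤ) := by omega
    have e3 : ((M i j : ℤ) - 3) / 2 = (h : ℤ) - 1 := by omega
    have e4 : (M i j : ℤ) / 2 = (h : ℤ) := by omega
    rw [e1, e2, e3, e4, eval_S_add_eval_S_two_mul_cos_of_odd h1] at this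
    simpa [simpleReflection] using this

end Geometric

variable {M : CoxeterMatrix B} (cs : CoxeterSystem M W)

/-- The geometric representation of a Coxeter group. -/
noncomputable def geometricRep : W →* ((B →₀ ℝ) ≃ₗ[ℝ] (B →₀ ℝ)) :=
  cs.lift ⟨simpleReflection M, isLiftable_simpleReflection M⟩

theorem geometricRep_simple_apply (i : B) (v : B →₀ ℝ) :
    cs.geometricRep (cs.simple i) v = v - simpleCoroot M i v • Finsupp.single i 1 := by
  rw [geometricRep, lift_apply_simple, simpleReflection_apply]

theorem geometricRep_simple_single (i j : B) :
    cs.geometricRep (cs.simple i) (Finsupp.single j 1) =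
      Finsupp.single j 1 - cartanCoeff M i j • Finsupp.single i 1 := by
  rw [geometricRep_simple_apply, simpleCoroot_single]

theorem geometricRep_simple_single_self (i : B) :
    cs.geometricRep (cs.simple i) (Finsupp.single i 1) = -Finsupp.single i 1 := by
  rw [geometricRep_simple_single, cartanCoeff_self]
  module

theorem geometricRep_wordProd_apply_of_notMem {l : List B} {p : B} (hp : p ∉ l) (v : B →₀ ℝ) :
    cs.geometricRep (cs.wordProd l) v p = v p := by
  induction l with
  | nil => simp
  | cons a l ih =>
    obtain ⟨h1, h2⟩ := not_or.mp (List.mem_cons.not.mp hp)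
    rw [wordProd_cons, map_mul, LinearEquiv.mul_apply, geometricRep_simple_apply]
    simp [ih h2, Finsupp.single_eq_of_ne h1]

theorem simple_injective : Function.Injective cs.simple := by
  intro i j h
  by_contra hij
  have h1 := cs.geometricRep_simple_single_self i
  rw [h, geometricRep_simple_single] at h1
  have h2 := DFunLike.congr_fun h1 i
  simp [Finsupp.single_eq_of_ne hij] at h2
  norm_num at h2

theorem adjacent_symm {s t : B} (h : cs.adjacent s t) : cs.adjacent t s :=
  ⟨h.1.symm, h.2.symm⟩

theorem cartanCoeff_ne_zero_of_adjacent {p q : B} (h : cs.adjacent p q) :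
    cartanCoeff M p q ≠ 0 := by
  have h1 := M.off_diagonal p q h.1
  change M p q ≠ 1 at h1
  have h2 : M p q ≠ 2 := by
    intro h2
    refine h.2 ?_
    have := cs.simple_mul_simple_pow p q
    rw [h2, pow_two, mul_eq_one_iff_eq_inv] at this
    simpa [simpleReflection] using this
  rcases Nat.eq_zero_or_pos (M p q) with h0 | h0
  · simp [cartanCoeff, h0]
  have h3 : (3 : ℝ) ≤ M p q := by exact_mod_cast (by omega : 3 ≤ M p q)
  have : 0 < Real.cos (Real.pi / M p q) := by
    refine Real.cos_pos_of_mem_Ioo ⟨?_, ?_⟩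
    · have : 0 < Real.pi / M p q := by positivity
      linarith [Real.pi_pos]
    · rw [div_lt_iff₀ (by linarith)]
      nlinarith [Real.pi_pos]
  simp [cartanCoeff, this.ne']

/-- Conjugating a simple reflection `q` by a product of distinct simple reflections different from
`q`, the last of which is adjacent to `q`, never yields a simple reflection. -/
theorem wordProd_concat_mul_simple_mul_inv_ne_simple {l : List B} {p q : B} (hp : p ∉ l)
    (hq : q ∉ l) (hpq : cs.adjacent p q) (x : B) :
    cs.wordProd (l ++ [p]) * cs.simple q * (cs.wordProd (l ++ [p]))⁻¹ ≠ cs.simple x := by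
  intro h
  rw [mul_inv_eq_iff_eq_mul] at h
  set g := cs.wordProd (l ++ [p]) with hg
  set y := cs.geometricRep g (Finsupp.single q 1) with hy
  have h1 : -y = y - simpleCoroot M x y • Finsupp.single x 1 := by
    rw [← cs.geometricRep_simple_apply, hy, ← LinearEquiv.mul_apply, ← map_mul, ← h, map_mul,
      LinearEquiv.mul_apply, geometricRep_simple_single_self, map_neg]
  have hyv : ∀ b, b ∉ l → y b =
      (Finsupp.single q 1 - cartanCoeff M p q • Finsupp.single p 1 : B →₀ ℝ) b := by
    intro b hb
    rw [hy, hg, wordProd_append, map_mul, LinearEquiv.mul_apply, wordProd_singleton,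
      geometricRep_wordProd_apply_of_notMem _ hb, geometricRep_simple_single]
  have hyq := hyv q hq
  have hyp := hyv p hp
  have hc := cs.cartanCoeff_ne_zero_of_adjacent hpq
  have hne := hpq.1
  simp [Finsupp.single_eq_of_ne hne, Finsupp.single_eq_of_ne hne.symm] at hyq hyp
  have hxq := DFunLike.congr_fun h1 q
  have hxp := DFunLike.congr_fun h1 p
  by_cases hqx : q = x
  · have : p ≠ x := fun h => hne (h.trans hqx.symm)
    simp [Finsupp.single_eq_of_ne this, hyp] at hxp
    exact hc (by linarith)
  · simp [Finsupp.single_eq_of_ne hqx, hyq] at hxq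
    norm_num at hxq

theorem wordProd_concat_ne_one {l : List B} {q : B} (hq : q ∉ l) :
    cs.wordProd (l ++ [q]) ≠ 1 := by
  intro h
  have h1 : cs.geometricRep (cs.wordProd (l ++ [q])) (Finsupp.single q 1) q = 1 := by simp [h]
  rw [wordProd_append, wordProd_singleton, map_mul, LinearEquiv.mul_apply,
    geometricRep_wordProd_apply_of_notMem _ hq, geometricRep_simple_single_self] at h1
  norm_num at h1

/-! ### The exchange condition -/

section Exchange

open Classical in
/-- The action of a simple reflection on pairs consisting of a group element and a sign. -/
noncomputable def signedConj (i : B) : Function.End (W × ZMod 2) :=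
  fun x => (cs.simple i * x.1 * cs.simple i, x.2 + if x.1 = cs.simple i then 1 else 0)

open Classical in
theorem signedConj_apply (i : B) (x : W × ZMod 2) : cs.signedConj i x =
    (cs.simple i * x.1 * cs.simple i, x.2 + if x.1 = cs.simple i then 1 else 0) :=
  rfl

theorem simple_mul_pow_mul_simple (i j : B) (n : ℕ) :
    cs.simple j * (cs.simple i * cs.simple j) ^ n =
      (cs.simple j * cs.simple i) ^ n * cs.simple j := by
  induction n with
  | zero => simp
  | succ n ih => rw [pow_succ, ← mul_assoc, ih, pow_succ]; simp only [mul_assoc]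

open Classical in
theorem signedConj_comp_iterate (i j : B) (n : ℕ) (x : W × ZMod 2) :
    (cs.signedConj i ∘ cs.signedConj j)^[n] x =
      ((cs.simple i * cs.simple j) ^ n * x.1 * (cs.simple j * cs.simple i) ^ n,
        x.2 + ∑ k ∈ Finset.range (2 * n),
          if x.1 = (cs.simple j * cs.simple i) ^ k * cs.simple j then 1 else 0) := by
  induction n with
  | zero => simp
  | succ n ih =>
    set a := cs.simple i
    set b := cs.simple j
    have hinv : ((b * a) ^ n)⁻¹ = (a * b) ^ n := by rw [← inv_pow]; simp [a, b]
    have hab : b * (a * b) ^ n = (b * a) ^ n * b := cs.simple_mul_pow_mul_simple i j n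
    have aa : a * a = 1 := cs.simple_mul_simple_self i
    have bb : b * b = 1 := cs.simple_mul_simple_self j
    have key : ∀ t r : W, (a * b) ^ n * t * (b * a) ^ n = r ↔
        t = (b * a) ^ n * r * (a * b) ^ n := by
      intro t r
      rw [← hinv]
      constructor
      · rintro rfl; group
      · rintro rfl; group
    have c1 : (a * b) ^ n * x.1 * (b * a) ^ n = b ↔ x.1 = (b * a) ^ (2 * n) * b := by
      rw [key, mul_assoc, hab, ← mul_assoc, ← pow_add, two_mul]
    have c2 : b * ((a * b) ^ n * x.1 * (b * a) ^ n) * b = a ↔ x.1 = (b * a) ^ (2 * n + 1) * b := by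
      have : b * ((a * b) ^ n * x.1 * (b * a) ^ n) * b = a ↔
          (a * b) ^ n * x.1 * (b * a) ^ n = b * a * b := by
        constructor
        · intro h
          calc _ = b * b * ((a * b) ^ n * x.1 * (b * a) ^ n) * (b * b) := by simp [bb]
            _ = b * (b * ((a * b) ^ n * x.1 * (b * a) ^ n) * b) * b := by simp only [mul_assoc]
            _ = b * a * b := by rw [h]
        · intro h
          rw [h]
          calc _ = b * b * a * (b * b) := by simp only [mul_assoc]
            _ = a := by simp [bb]
      have e : (b * a) ^ n * (b * a * b) * (a * b) ^ n = (b * a) ^ (2 * n + 1) * b := by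
        calc _ = (b * a) ^ n * (b * a) * (b * (a * b) ^ n) := by simp only [mul_assoc]
          _ = (b * a) ^ (n + 1) * (b * a) ^ n * b := by rw [hab, ← pow_succ, mul_assoc]
          _ = _ := by rw [← pow_add]; congr 2; omega
      rw [this, key, e]
    rw [Function.iterate_succ_apply', ih]
    change cs.signedConj i (cs.signedConj j _) = _
    rw [signedConj_apply, signedConj_apply]
    refine Prod.ext ?_ ?_
    · simp only
      rw [pow_succ', pow_succ]
      simp only [mul_assoc, a, b]
    · simp only
      rw [show 2 * (n + 1) = 2 * n + 1 + 1 by ring, Finset.sum_range_succ, Finset.sum_range_succ]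
      simp only [a, b] at c1 c2 ⊢
      simp only [c1, c2, add_assoc]

theorem isLiftable_signedConj :
    M.IsLiftable cs.signedConj := by
  classical
  intro i j
  funext x
  change (cs.signedConj i ∘ cs.signedConj j)^[M i j] x = x
  rw [signedConj_comp_iterate, simple_mul_simple_pow, simple_mul_simple_pow', two_mul,
    Finset.sum_range_add]
  simp only [pow_add, simple_mul_simple_pow', one_mul, mul_one]
  rw [CharTwo.add_self_eq_zero, add_zero]

/-- The action of a Coxeter group on signed group elements that detects inversions. -/
noncomputable def signedConjHom : W →* Function.End (W × ZMod 2) :=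
  cs.lift ⟨cs.signedConj, cs.isLiftable_signedConj⟩

open Classical in
theorem signedConjHom_wordProd (ω : List B) (x : W × ZMod 2) :
    cs.signedConjHom (cs.wordProd ω) x =
      (cs.wordProd ω * x.1 * (cs.wordProd ω)⁻¹, x.2 + (cs.rightInvSeq ω).count x.1) := by
  induction ω with
  | nil =>
    rw [wordProd_nil, map_one]
    simpa using Function.End.one_def ▸ rfl
  | cons i ω ih =>
    rw [wordProd_cons, map_mul]
    change cs.signedConjHom (cs.simple i) (cs.signedConjHom (cs.wordProd ω) x) = _
    rw [ih, signedConjHom, lift_apply_simple, signedConj_apply, rightInvSeq, List.count_cons]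
    have : cs.wordProd ω * x.1 * (cs.wordProd ω)⁻¹ = cs.simple i ↔
        (cs.wordProd ω)⁻¹ * cs.simple i * cs.wordProd ω = x.1 := by
      constructor
      · intro h; rw [← h]; group
      · intro h; rw [← h]; group
    refine Prod.ext ?_ ?_
    · simp [mul_assoc]
    · simp only [this, beq_iff_eq]
      push_cast
      ring

theorem simple_mem_rightInvSeq {ω : List B} {i : B}
    (h : cs.length (cs.wordProd ω * cs.simple i) < cs.length (cs.wordProd ω)) :
    cs.simple i ∈ cs.rightInvSeq ω := by
  classical
  by_contra hn
  obtain ⟨ω', hω', he⟩ := cs.exists_isReduced (cs.wordProd ω * cs.simple i)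
  have h1 : (cs.signedConjHom (cs.wordProd ω') (cs.simple i, 0)).2 = 1 := by
    rw [← he, map_mul]
    change (cs.signedConjHom (cs.wordProd ω)
      (cs.signedConjHom (cs.simple i) (cs.simple i, 0))).2 = 1
    rw [← wordProd_singleton cs i, signedConjHom_wordProd, signedConjHom_wordProd]
    simp [List.count_eq_zero_of_not_mem hn]
  have h2 : cs.simple i ∈ cs.rightInvSeq ω' := by
    by_contra hn'
    rw [signedConjHom_wordProd, List.count_eq_zero_of_not_mem hn'] at h1
    simp at h1
  have h3 := (cs.isRightInversion_of_mem_rightInvSeq hω' h2).2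
  rw [← he] at h3
  simp at h3
  omega

/-- The exchange condition, for multiplication on the left. -/
theorem exists_wordProd_eraseIdx_left {ω : List B} {i : B}
    (h : cs.length (cs.simple i * cs.wordProd ω) < cs.length (cs.wordProd ω)) :
    ∃ k < ω.length, cs.simple i * cs.wordProd ω = cs.wordProd (ω.eraseIdx k) := by
  have h' : cs.length (cs.wordProd ω.reverse * cs.simple i) <
      cs.length (cs.wordProd ω.reverse) := by
    rw [wordProd_reverse, length_inv, ← length_inv]
    simpa using h
  have hm := cs.simple_mem_rightInvSeq h'
  rw [rightInvSeq_reverse, List.mem_reverse] at hm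
  obtain ⟨k, hk, he⟩ := List.mem_iff_getElem.mp hm
  refine ⟨k, by simpa using hk, ?_⟩
  rw [← getD_leftInvSeq_mul_wordProd, List.getD_eq_getElem _ _ hk, he]

end Exchange

/-! ### Parabolic double cosets -/

section Parabolic

variable {I J I' J' : Set B} {w : W}

theorem simple_mem_parabolic {i : B} (hi : i ∈ I) : cs.simple i ∈ cs.parabolic I :=
  Subgroup.subset_closure ⟨i, hi, rfl⟩

theorem wordProd_mem_parabolic {l : List B} (hl : ∀ i ∈ l, i ∈ I) :
    cs.wordProd l ∈ cs.parabolic I := by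
  induction l with
  | nil => simp
  | cons i l ih =>
    rw [wordProd_cons]
    exact mul_mem (cs.simple_mem_parabolic (hl i (by simp))) (ih fun j hj => hl j (by simp [hj]))

theorem parabolic_mono (h : I ⊆ J) : cs.parabolic I ≤ cs.parabolic J :=
  Subgroup.closure_mono (Set.image_mono h)

theorem parabolic_empty : cs.parabolic ∅ = ⊥ := by
  simp [parabolic]

theorem parabolic_induction {p : (x : W) → x ∈ cs.parabolic I → Prop} (one : p 1 (one_mem _))
    (mul : ∀ s (hs : s ∈ I) x (hx : x ∈ cs.parabolic I), p x hx →
      p (cs.simple s * x) (mul_mem (cs.simple_mem_parabolic hs) hx)) {x : W}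
    (hx : x ∈ cs.parabolic I) : p x hx := by
  refine Subgroup.closure_induction_left one ?_ ?_ hx
  · rintro _ ⟨s, hs, rfl⟩ y hy hp
    exact mul s hs y hy hp
  · rintro _ ⟨s, hs, rfl⟩ y hy hp
    simp only [inv_simple]
    exact mul s hs y hy hp

theorem inv_mem_doubleCoset {x : W} (hx : x ∈ cs.doubleCoset I w J) :
    x⁻¹ ∈ cs.doubleCoset J w⁻¹ I := by
  obtain ⟨u, hu, v, hv, rfl⟩ := hx
  exact ⟨v⁻¹, inv_mem hv, u⁻¹, inv_mem hu, by group⟩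

theorem inv_mem_doubleCoset_iff {x : W} :
    x⁻¹ ∈ cs.doubleCoset J w⁻¹ I ↔ x ∈ cs.doubleCoset I w J :=
  ⟨fun h => by simpa using cs.inv_mem_doubleCoset h, cs.inv_mem_doubleCoset⟩

theorem doubleCoset_inv_eq (h : cs.doubleCoset I' w J' = cs.doubleCoset I w J) :
    cs.doubleCoset J' w⁻¹ I' = cs.doubleCoset J w⁻¹ I := by
  ext x
  rw [← inv_inv x, inv_mem_doubleCoset_iff, inv_mem_doubleCoset_iff, h]

theorem self_mem_doubleCoset : w ∈ cs.doubleCoset I w J :=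
  ⟨1, one_mem _, 1, one_mem _, by simp⟩

theorem mul_mem_doubleCoset {u x v : W} (hu : u ∈ cs.parabolic I) (hv : v ∈ cs.parabolic J)
    (hx : x ∈ cs.doubleCoset I w J) : u * x * v ∈ cs.doubleCoset I w J := by
  obtain ⟨a, ha, b, hb, rfl⟩ := hx
  exact ⟨u * a, mul_mem hu ha, b * v, mul_mem hb hv, by group⟩

/-- The exchange condition for a product of a word, a group element and another word. -/
theorem exchange_mul_mul {a b : List B} {s : B}
    (h : cs.length (cs.simple s * (cs.wordProd a * w * cs.wordProd b)) <
      cs.length (cs.wordProd a * w * cs.wordProd b)) :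
    (∃ k < a.length, cs.simple s * cs.wordProd a = cs.wordProd (a.eraseIdx k)) ∨
      (∃ w', cs.length w' < cs.length w ∧ cs.simple s * cs.wordProd a * w = cs.wordProd a * w') ∨
      ∃ k < b.length, cs.simple s * (cs.wordProd a * w * cs.wordProd b) =
        cs.wordProd a * w * cs.wordProd (b.eraseIdx k) := by
  obtain ⟨ω, hω, rfl⟩ := cs.exists_isReduced w
  rw [← wordProd_append, ← wordProd_append] at h
  obtain ⟨k, hk, he⟩ := cs.exists_wordProd_eraseIdx_left h
  rcases Nat.lt_or_ge k (a ++ ω).length with h1 | h1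
  · rw [List.eraseIdx_append_of_lt_length h1] at he
    rcases Nat.lt_or_ge k a.length with h2 | h2
    · left
      rw [List.eraseIdx_append_of_lt_length h2] at he
      simp only [wordProd_append, ← mul_assoc, mul_left_inj] at he
      exact ⟨k, h2, he⟩
    · right; left
      rw [List.eraseIdx_append_of_length_le h2] at he
      refine ⟨cs.wordProd (ω.eraseIdx (k - a.length)), ?_, ?_⟩
      · rw [hω.eq]
        rw [List.length_append] at h1
        refine (cs.length_wordProd_le _).trans_lt ?_
        rw [List.length_eraseIdx_of_lt (by omega)]
        omega
      · simpa only [wordProd_append, ← mul_assoc, mul_left_inj] using he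
  · right; right
    rw [List.eraseIdx_append_of_length_le h1] at he
    refine ⟨k - (a ++ ω).length, ?_, ?_⟩
    · rw [List.length_append] at hk
      omega
    · simpa only [wordProd_append, ← mul_assoc] using he

/-- `x` is a product of a word in `I`, the element `w` and a word in `J`, with additive lengths. -/
def HasReducedFactorization (I : Set B) (w : W) (J : Set B) (x : W) : Prop :=
  ∃ a b : List B, (∀ i ∈ a, i ∈ I) ∧ (∀ i ∈ b, i ∈ J) ∧
    x = cs.wordProd a * w * cs.wordProd b ∧ cs.length x = a.length + cs.length w + b.length

variable {cs} in
theorem HasReducedFactorization.inv {x : W} (h : cs.HasReducedFactorization I w J x) :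
    cs.HasReducedFactorization J w⁻¹ I x⁻¹ := by
  obtain ⟨a, b, ha, hb, rfl, hl⟩ := h
  refine ⟨b.reverse, a.reverse, by simpa using hb, by simpa using ha, ?_, ?_⟩
  · simp [mul_assoc]
  · simp only [length_inv, List.length_reverse, hl]
    omega

variable {cs} in
theorem HasReducedFactorization.simple_mul
    (hw : ∀ x ∈ cs.parabolic I, cs.length w ≤ cs.length (x * w)) {x : W} {s : B} (hs : s ∈ I)
    (h : cs.HasReducedFactorization I w J x) :
    cs.HasReducedFactorization I w J (cs.simple s * x) := by
  obtain ⟨a, b, ha, hb, rfl, hl⟩ := h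
  rcases cs.length_simple_mul (cs.wordProd a * w * cs.wordProd b) s with h | h
  · refine ⟨s :: a, b, ?_, hb, ?_, ?_⟩
    · simpa [hs] using ha
    · simp [wordProd_cons, mul_assoc]
    · rw [h, hl, List.length_cons]
      omega
  · have hdesc : cs.length (cs.simple s * (cs.wordProd a * w * cs.wordProd b)) <
        cs.length (cs.wordProd a * w * cs.wordProd b) := by omega
    rcases cs.exchange_mul_mul hdesc with ⟨k, hk, he⟩ | ⟨w', hw', he⟩ | ⟨k, hk, he⟩
    · refine ⟨a.eraseIdx k, b, fun i hi => ha i (List.mem_of_mem_eraseIdx hi), hb, ?_, ?_⟩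
      · rw [← he]
        simp only [mul_assoc]
      · rw [List.length_eraseIdx_of_lt hk]
        omega
    · have hm : (cs.wordProd a)⁻¹ * cs.simple s * cs.wordProd a ∈ cs.parabolic I :=
        mul_mem (mul_mem (inv_mem (cs.wordProd_mem_parabolic ha)) (cs.simple_mem_parabolic hs))
          (cs.wordProd_mem_parabolic ha)
      have h1 := hw _ hm
      rw [mul_assoc, mul_assoc, ← mul_assoc (cs.simple s), he, inv_mul_cancel_left] at h1
      omega
    · refine ⟨a, b.eraseIdx k, ha, fun i hi => hb i (List.mem_of_mem_eraseIdx hi), he, ?_⟩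
      rw [List.length_eraseIdx_of_lt hk]
      omega

theorem hasReducedFactorization_of_le
    (hI : ∀ x ∈ cs.parabolic I, cs.length w ≤ cs.length (x * w))
    (hJ : ∀ x ∈ cs.parabolic J, cs.length w ≤ cs.length (w * x)) {x : W}
    (hx : x ∈ cs.doubleCoset I w J) : cs.HasReducedFactorization I w J x := by
  obtain ⟨u, hu, v, hv, rfl⟩ := hx
  have h1 : ∀ y ∈ cs.parabolic J, cs.HasReducedFactorization J w⁻¹ I (y * w⁻¹) := by
    intro y hy
    induction hy using cs.parabolic_induction with
    | one => exact ⟨[], [], by simp, by simp, by simp, by simp⟩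
    | mul s hs y hy ih =>
      rw [mul_assoc]
      refine ih.simple_mul (fun x hx => ?_) hs
      have := hJ _ (inv_mem hx)
      rwa [← length_inv, ← cs.length_inv (w * x⁻¹), mul_inv_rev, inv_inv] at this
  induction hu using cs.parabolic_induction with
  | one => simpa using (h1 v⁻¹ (inv_mem hv)).inv
  | mul s hs y hy ih =>
    rw [mul_assoc, mul_assoc, ← mul_assoc y]
    exact ih.simple_mul hI hs

theorem length_le_length_mul_of_left_ascents
    (hI : ∀ s ∈ I, cs.length w < cs.length (cs.simple s * w)) {x : W} (hx : x ∈ cs.parabolic I) :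
    cs.length w ≤ cs.length (x * w) := by
  obtain ⟨y, hy, hmin⟩ := (measure fun x : W => cs.length (x * w)).wf.has_min
    (cs.parabolic I : Set W) ⟨1, one_mem _⟩
  have hmin' : ∀ z ∈ cs.parabolic I, cs.length (y * w) ≤ cs.length (z * w) :=
    fun z hz => not_lt.mp (hmin z hz)
  have hmem : w ∈ cs.doubleCoset I (y * w) ∅ := ⟨y⁻¹, inv_mem hy, 1, one_mem _, by simp⟩
  obtain ⟨a, b, ha, hb, he, hl⟩ := cs.hasReducedFactorization_of_le
    (fun z hz => by rw [← mul_assoc]; exact hmin' _ (mul_mem hz hy))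
    (fun z hz => by
      rw [parabolic_empty, Subgroup.mem_bot] at hz
      simp [hz]) hmem
  obtain rfl : b = [] := List.eq_nil_iff_forall_not_mem.mpr hb
  cases a with
  | nil =>
    simp only [List.length_nil, zero_add, add_zero] at hl
    rw [hl]
    exact hmin' x hx
  | cons s a =>
    have h1 := hI s (ha s (by simp))
    have h2 : cs.simple s * w = cs.wordProd a * (y * w) := by
      nth_rw 1 [he]
      simp [wordProd_cons, mul_assoc]
    have h3 := cs.length_mul_le (cs.wordProd a) (y * w)
    have h4 := cs.length_wordProd_le a
    rw [h2] at h1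
    simp only [List.length_cons, List.length_nil] at hl
    omega

theorem left_ascents_inv (hJ : ∀ s ∈ J, cs.length w < cs.length (w * cs.simple s)) :
    ∀ s ∈ J, cs.length w⁻¹ < cs.length (cs.simple s * w⁻¹) := by
  intro s hs
  have := hJ s hs
  rwa [← length_inv, ← cs.length_inv (w * _), mul_inv_rev, inv_simple] at this

theorem right_ascents_inv (hI : ∀ s ∈ I, cs.length w < cs.length (cs.simple s * w)) :
    ∀ s ∈ I, cs.length w⁻¹ < cs.length (w⁻¹ * cs.simple s) := by
  intro s hs
  have := hI s hs
  rwa [← length_inv, ← cs.length_inv (_ * w), mul_inv_rev, inv_simple] at this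

theorem hasReducedFactorization_of_ascents
    (hI : ∀ s ∈ I, cs.length w < cs.length (cs.simple s * w))
    (hJ : ∀ s ∈ J, cs.length w < cs.length (w * cs.simple s)) {x : W}
    (hx : x ∈ cs.doubleCoset I w J) : cs.HasReducedFactorization I w J x := by
  refine cs.hasReducedFactorization_of_le
    (fun x hx => cs.length_le_length_mul_of_left_ascents hI hx) (fun x hx => ?_) hx
  have := cs.length_le_length_mul_of_left_ascents (cs.left_ascents_inv hJ) (inv_mem hx)
  rwa [← mul_inv_rev, length_inv, length_inv] at this

theorem left_ascents_of_doubleCoset_eq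
    (hI : ∀ s ∈ I, cs.length w < cs.length (cs.simple s * w))
    (hJ : ∀ s ∈ J, cs.length w < cs.length (w * cs.simple s))
    (h : cs.doubleCoset I' w J' = cs.doubleCoset I w J) :
    ∀ s ∈ I', cs.length w < cs.length (cs.simple s * w) := by
  intro s hs
  have hm : cs.simple s * w ∈ cs.doubleCoset I' w J' := by
    simpa using cs.mul_mem_doubleCoset (cs.simple_mem_parabolic hs) (one_mem _)
      cs.self_mem_doubleCoset
  rw [h] at hm
  obtain ⟨a, b, -, -, -, hl⟩ := cs.hasReducedFactorization_of_ascents hI hJ hm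
  have := cs.length_simple_mul_ne w s
  omega

theorem right_ascents_of_doubleCoset_eq
    (hI : ∀ s ∈ I, cs.length w < cs.length (cs.simple s * w))
    (hJ : ∀ s ∈ J, cs.length w < cs.length (w * cs.simple s))
    (h : cs.doubleCoset I' w J' = cs.doubleCoset I w J) :
    ∀ s ∈ J', cs.length w < cs.length (w * cs.simple s) := by
  have := cs.right_ascents_inv (cs.left_ascents_of_doubleCoset_eq (cs.left_ascents_inv hJ)
    (cs.right_ascents_inv hI) (cs.doubleCoset_inv_eq h))
  simpa using this

/-- If conjugating a letter of a path in the Coxeter graph by the product of the letters before it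
yields a simple reflection, then that letter is the first one. -/
theorem eq_nil_of_wordProd_conj_eq_simple {l₁ l₂ : List B} {c t : B}
    (hch : (l₁ ++ c :: l₂).IsChain cs.adjacent) (hnd : (l₁ ++ c :: l₂).Nodup)
    (h : cs.wordProd l₁ * cs.simple c * (cs.wordProd l₁)⁻¹ = cs.simple t) : l₁ = [] := by
  induction l₁ using List.reverseRecOn with
  | nil => rfl
  | append_singleton l p _ =>
    exfalso
    rw [List.append_assoc] at hch hnd
    have hadj : cs.adjacent p c := by
      have := hch.right_of_append
      simp at this
      exact this.1
    refine cs.wordProd_concat_mul_simple_mul_inv_ne_simple (fun hp => ?_) (fun hc => ?_) hadj t h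
    · exact List.disjoint_of_nodup_append hnd hp (by simp)
    · exact List.disjoint_of_nodup_append hnd hc (by simp)

theorem exists_eq_append_of_mul_wordProd_eq {l : List B} {k : ℕ} (hk : k < l.length) {r : W}
    (h : r * cs.wordProd l = cs.wordProd (l.eraseIdx k)) :
    ∃ l₁ c l₂, l = l₁ ++ c :: l₂ ∧ r = cs.wordProd l₁ * cs.simple c * (cs.wordProd l₁)⁻¹ := by
  have e : l.take k ++ l[k] :: l.drop (k + 1) = l := by simp
  refine ⟨l.take k, l[k], l.drop (k + 1), e.symm, ?_⟩
  rw [List.eraseIdx_eq_take_drop_succ] at h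
  nth_rw 1 [← e] at h
  rw [wordProd_append, wordProd_append, wordProd_cons, ← mul_assoc, ← mul_assoc, mul_left_inj] at h
  rw [eq_mul_inv_iff_mul_eq, ← cs.simple_mul_simple_cancel_right (w := r * _) l[k], h]

/-- A path in the Coxeter graph with vertices in `I` whose product times `w` lies in
`W_{I'} w W_{J'}` starts in `I'` or ends in `w J' w⁻¹`. -/
theorem head_mem_or_getLast_mem (hI : ∀ s ∈ I, cs.length w < cs.length (cs.simple s * w))
    (hI' : ∀ s ∈ I', cs.length w < cs.length (cs.simple s * w))
    (hJ' : ∀ s ∈ J', cs.length w < cs.length (w * cs.simple s)) {l : List B} (hne : l ≠ [])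
    (hl : ∀ i ∈ l, i ∈ I) (hch : l.IsChain cs.adjacent) (hnd : l.Nodup)
    (hm : cs.wordProd l * w ∈ cs.doubleCoset I' w J') :
    l.head hne ∈ I' ∨ ∃ t ∈ J', cs.simple (l.getLast hne) = w * cs.simple t * w⁻¹ := by
  obtain ⟨a, b, ha, hb, he, hlen⟩ := cs.hasReducedFactorization_of_ascents hI' hJ' hm
  rcases a with _ | ⟨t, a⟩
  · rcases List.eq_nil_or_concat b with rfl | ⟨b, t, hbt⟩
    · exfalso
      rw [wordProd_nil, one_mul, mul_one, mul_eq_right] at he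
      rw [← List.dropLast_append_getLast hne] at he hnd
      exact cs.wordProd_concat_ne_one
        (fun h => List.disjoint_of_nodup_append hnd h (by simp)) he
    rw [List.concat_eq_append] at hbt
    subst hbt
    right
    have ht : t ∈ J' := hb t (by simp)
    refine ⟨t, ht, ?_⟩
    have hinv : (cs.wordProd l * w)⁻¹ =
        cs.wordProd [] * w⁻¹ * cs.wordProd l.reverse := by simp
    have hdesc : cs.length (cs.simple t * (cs.wordProd [] * w⁻¹ * cs.wordProd l.reverse)) <
        cs.length (cs.wordProd [] * w⁻¹ * cs.wordProd l.reverse) := by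
      rw [← hinv, length_inv, hlen, ← length_inv, mul_inv_rev, inv_inv, inv_simple, he,
        wordProd_append, wordProd_singleton, ← mul_assoc, simple_mul_simple_cancel_right,
        wordProd_nil, one_mul]
      have h1 := cs.length_mul_le w (cs.wordProd b)
      have h2 := cs.length_wordProd_le b
      simp only [List.length_append, List.length_singleton, List.length_nil]
      omega
    rcases cs.exchange_mul_mul hdesc with ⟨k, hk, -⟩ | ⟨w', hw', he'⟩ | ⟨k, hk, he'⟩
    · simp at hk
    · exfalso
      have := cs.left_ascents_inv hJ' t ht
      simp only [wordProd_nil, mul_one, one_mul] at he'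
      rw [he'] at this
      omega
    · have he'' : w * cs.simple t * w⁻¹ * cs.wordProd l.reverse =
          cs.wordProd (l.reverse.eraseIdx k) := by
        simp only [wordProd_nil, one_mul] at he'
        rw [mul_assoc, mul_assoc, he', mul_inv_cancel_left]
      obtain ⟨l₁, c, l₂, hsplit, hr⟩ := cs.exists_eq_append_of_mul_wordProd_eq hk he''
      have hrI : w * cs.simple t * w⁻¹ ∈ cs.parabolic I := by
        have hsub : ∀ i ∈ l₁ ++ c :: l₂, i ∈ I := by
          rw [← hsplit]
          simpa using hl
        have h₁ := cs.wordProd_mem_parabolic (I := I) (l := l₁) fun i hi => hsub i (by simp [hi])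
        rw [hr]
        exact mul_mem (mul_mem h₁ (cs.simple_mem_parabolic (hsub c (by simp)))) (inv_mem h₁)
      obtain ⟨a', b', -, hb', hfac, hlen'⟩ := cs.hasReducedFactorization_of_ascents (J := ∅) hI
        (by simp) ⟨_, hrI, 1, one_mem _, rfl⟩
      obtain rfl : b' = [] := List.eq_nil_iff_forall_not_mem.mpr hb'
      have ha' : a'.length = 1 := by
        rw [mul_one, inv_mul_cancel_right] at hlen'
        have h1 := hJ' t ht
        have h2 := cs.length_mul_simple w t
        simp only [List.length_nil] at hlen'
        omega
      obtain ⟨x, rfl⟩ := List.length_eq_one_iff.mp ha'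
      rw [wordProd_nil, mul_one, mul_one, wordProd_singleton, mul_left_inj] at hfac
      have hrev : (l₁ ++ c :: l₂).IsChain cs.adjacent := by
        rw [← hsplit, List.isChain_reverse]
        exact hch.imp fun _ _ => cs.adjacent_symm
      obtain rfl := cs.eq_nil_of_wordProd_conj_eq_simple hrev
        (by rw [← hsplit]; exact List.nodup_reverse.mpr hnd) (hr.symm.trans hfac)
      have hlast : l.getLast hne = c := by
        rw [← List.head_reverse (by simpa using hne)]
        simp [hsplit]
      rw [hr, hlast]
      simp
  · left
    have ht : t ∈ I' := ha t (by simp)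
    have hdesc : cs.length (cs.simple t * (cs.wordProd l * w * cs.wordProd [])) <
        cs.length (cs.wordProd l * w * cs.wordProd []) := by
      rw [wordProd_nil, mul_one, hlen, he, wordProd_cons, mul_assoc, mul_assoc,
        simple_mul_simple_cancel_left]
      have h1 := cs.length_mul_le (cs.wordProd a) (w * cs.wordProd b)
      have h2 := cs.length_mul_le w (cs.wordProd b)
      have h3 := cs.length_wordProd_le a
      have h4 := cs.length_wordProd_le b
      simp only [List.length_cons]
      omega
    rcases cs.exchange_mul_mul hdesc with ⟨k, hk, he'⟩ | ⟨w', hw', he'⟩ | ⟨k, hk, -⟩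
    · obtain ⟨l₁, c, l₂, rfl, hr⟩ := cs.exists_eq_append_of_mul_wordProd_eq hk he'
      obtain rfl := cs.eq_nil_of_wordProd_conj_eq_simple hch hnd hr.symm
      have : t = c := cs.simple_injective (by simpa using hr)
      simpa [← this] using ht
    · exfalso
      have hlm : cs.wordProd l ∈ cs.parabolic (I ∪ I') :=
        cs.wordProd_mem_parabolic fun i hi => Or.inl (hl i hi)
      have hmem : (cs.wordProd l)⁻¹ * cs.simple t * cs.wordProd l ∈ cs.parabolic (I ∪ I') :=
        mul_mem (mul_mem (inv_mem hlm) (cs.simple_mem_parabolic (Or.inr ht))) hlm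
      have h1 := cs.length_le_length_mul_of_left_ascents (w := w)
        (fun s hs => hs.elim (hI s) (hI' s)) hmem
      rw [mul_assoc, mul_assoc, ← mul_assoc (cs.simple t), he', inv_mul_cancel_left] at h1
      omega
    · simp at hk

end Parabolic

/-! ### Minimal presentations -/

section Minimal

variable {I J I' J' : Set B} {w : W}

theorem mem_component_self (i : B) : i ∈ cs.component I i :=
  Relation.ReflTransGen.refl

theorem mem_of_mem_component {i j : B} (hi : i ∈ I) (hj : j ∈ cs.component I i) : j ∈ I := by
  rcases Relation.ReflTransGen.cases_tail hj with rfl | ⟨k, -, hk⟩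
  · exact hi
  · exact hk.2.1

theorem mem_component_symm {i j : B} (h : j ∈ cs.component I i) : i ∈ cs.component I j := by
  induction h with
  | refl => exact cs.mem_component_self i
  | tail _ hbc ih =>
    exact Relation.ReflTransGen.head ⟨hbc.2.1, hbc.1, cs.adjacent_symm hbc.2.2⟩ ih

theorem mem_component_trans {i j k : B} (h : j ∈ cs.component I i) (h' : k ∈ cs.component I j) :
    k ∈ cs.component I i :=
  Relation.ReflTransGen.trans h h'

theorem exists_path_of_mem_component {i j : B} (hi : i ∈ I) (hj : j ∈ cs.component I i) :
    ∃ (l : List B) (hne : l ≠ []), (∀ k ∈ l, k ∈ I) ∧ l.IsChain cs.adjacent ∧ l.Nodup ∧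
      l.head hne = i ∧ l.getLast hne = j := by
  let G : SimpleGraph B :=
    { Adj := fun a b => a ∈ I ∧ b ∈ I ∧ cs.adjacent a b
      symm := ⟨fun _ _ h => ⟨h.2.1, h.1, cs.adjacent_symm h.2.2⟩⟩
      loopless := ⟨fun _ h => h.2.2.1 rfl⟩ }
  obtain ⟨p, hp⟩ := ((G.reachable_iff_reflTransGen i j).mpr hj).exists_isPath
  refine ⟨p.support, p.support_ne_nil, fun k hk => ?_, ?_, hp.support_nodup, by simp, by simp⟩
  · classical
    exact cs.mem_of_mem_component hi
      ((G.reachable_iff_reflTransGen i k).mp ⟨p.takeUntil k hk⟩)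
  · exact p.isChain_adj_support.imp fun _ _ h => h.2.2

theorem mem_or_mem_of_mem_component
    (hI : ∀ s ∈ I, cs.length w < cs.length (cs.simple s * w))
    (hI' : ∀ s ∈ I', cs.length w < cs.length (cs.simple s * w))
    (hJ' : ∀ s ∈ J', cs.length w < cs.length (w * cs.simple s))
    (h : cs.doubleCoset I' w J' = cs.doubleCoset I w J) {i j : B} (hi : i ∈ I)
    (hj : j ∈ cs.component I i) :
    i ∈ I' ∨ ∃ t ∈ J', cs.simple j = w * cs.simple t * w⁻¹ := by
  obtain ⟨l, hne, hl, hch, hnd, rfl, rfl⟩ := cs.exists_path_of_mem_component hi hj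
  refine cs.head_mem_or_getLast_mem hI hI' hJ' hne hl hch hnd ?_
  rw [h]
  exact ⟨_, cs.wordProd_mem_parabolic hl, 1, one_mem _, by simp⟩

variable {cs} in
theorem IsMinimalPresentation.inv (h : cs.IsMinimalPresentation I w J) :
    cs.IsMinimalPresentation J w⁻¹ I :=
  ⟨cs.left_ascents_inv h.2.1, cs.right_ascents_inv h.1, by simpa using h.2.2.2,
    by simpa using h.2.2.1⟩

variable {cs} in
theorem IsMinimalPresentation.mem_of_simple_eq_conj (h : cs.IsMinimalPresentation I w J)
    (hC : cs.doubleCoset I' w J' = cs.doubleCoset I w J) {s t : B} (hs : s ∈ I) (ht : t ∈ J)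
    (hst : cs.simple s = w * cs.simple t * w⁻¹) : s ∈ I' := by
  obtain ⟨hI, hJ, hK, hN⟩ := h
  have hI' := cs.left_ascents_of_doubleCoset_eq hI hJ hC
  have hJ' := cs.right_ascents_of_doubleCoset_eq hI hJ hC
  have conj_iff : ∀ a b : B, cs.simple a = w⁻¹ * cs.simple b * w ↔
      cs.simple b = w * cs.simple a * w⁻¹ := by
    intro a b
    constructor
    · intro h; rw [h]; group
    · intro h; rw [h]; group
  by_contra hsI'
  obtain ⟨s₁, hs₁, hs₁J⟩ := Set.not_subset.mp (hK s hs)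
  obtain ⟨n, hn, hnI⟩ := Set.not_subset.mp (hN t ht)
  have hKJ' : ∀ k ∈ cs.component I s, ∃ t' ∈ J', cs.simple k = w * cs.simple t' * w⁻¹ :=
    fun k hk => (cs.mem_or_mem_of_mem_component hI hI' hJ' hC hs hk).resolve_left hsI'
  have hNJ' : ∀ m ∈ cs.component J t, m ∈ J' := by
    intro m hm
    rcases cs.mem_or_mem_of_mem_component (cs.left_ascents_inv hJ) (cs.left_ascents_inv hJ')
      (cs.right_ascents_inv hI') (cs.doubleCoset_inv_eq hC) (cs.mem_of_mem_component ht hm)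
      (cs.mem_component_symm hm) with h | ⟨i, hi, he⟩
    · exact h
    · rw [inv_inv, conj_iff, ← hst] at he
      exact absurd (cs.simple_injective he ▸ hi) hsI'
  have hconj : ∀ k ∈ cs.component I s, ∃ t' ∈ cs.component J' t,
      cs.simple k = w * cs.simple t' * w⁻¹ := by
    intro k hk
    induction hk with
    | refl => exact ⟨t, cs.mem_component_self t, hst⟩
    | @tail b c hb hbc ih =>
      obtain ⟨tb, htb, heb⟩ := ih
      obtain ⟨tc, htc, hec⟩ := hKJ' c (Relation.ReflTransGen.tail hb hbc)
      refine ⟨tc, Relation.ReflTransGen.tail htb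
        ⟨cs.mem_of_mem_component (hNJ' t (cs.mem_component_self t)) htb, htc, ?_, ?_⟩, hec⟩
      · rintro rfl
        exact hbc.2.2.1 (cs.simple_injective (heb.trans hec.symm))
      · intro hcomm
        refine hbc.2.2.2 ?_
        rw [heb, hec]
        calc _ = w * (cs.simple tb * cs.simple tc) * w⁻¹ := by group
          _ = w * (cs.simple tc * cs.simple tb) * w⁻¹ := by rw [hcomm]
          _ = _ := by group
  have hnJ' : n ∈ cs.component J' t := by
    have key : ∀ m ∈ cs.component J t, m ∈ cs.component J' t := by
      intro m hm
      induction hm with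
      | refl => exact cs.mem_component_self t
      | @tail b c hb hbc ih =>
        exact Relation.ReflTransGen.tail ih
          ⟨hNJ' b hb, hNJ' c (Relation.ReflTransGen.tail hb hbc), hbc.2.2⟩
    exact key n hn
  obtain ⟨t₁, ht₁, he₁⟩ := hconj s₁ hs₁
  rcases cs.mem_or_mem_of_mem_component (cs.left_ascents_inv hJ') (cs.left_ascents_inv hJ)
    (cs.right_ascents_inv hI) (cs.doubleCoset_inv_eq hC.symm)
    (cs.mem_of_mem_component (hNJ' t (cs.mem_component_self t)) ht₁)
    (cs.mem_component_trans (cs.mem_component_symm ht₁) hnJ') with h | ⟨i, hi, he⟩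
  · exact hs₁J ⟨t₁, h, he₁⟩
  · exact hnI ⟨i, hi, by simpa using he⟩

variable {cs} in
theorem IsMinimalPresentation.ncard_diff_le [Finite B] (h : cs.IsMinimalPresentation I w J)
    (hC : cs.doubleCoset I' w J' = cs.doubleCoset I w J) :
    (I \ I').ncard ≤ (J' \ J).ncard := by
  have hI' := cs.left_ascents_of_doubleCoset_eq h.1 h.2.1 hC
  have hJ' := cs.right_ascents_of_doubleCoset_eq h.1 h.2.1 hC
  have key : ∀ s ∈ I \ I', ∃ t ∈ J', cs.simple s = w * cs.simple t * w⁻¹ := fun s hs =>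
    (cs.mem_or_mem_of_mem_component h.1 hI' hJ' hC hs.1 (cs.mem_component_self s)).resolve_left hs.2
  choose! f hf hfe using key
  refine Set.ncard_le_ncard_of_injOn f (fun s hs => ⟨hf s hs, fun hsJ => ?_⟩)
    (fun a ha b hb hab => ?_) (Set.toFinite _)
  · exact hs.2 (h.mem_of_simple_eq_conj hC hs.1 hsJ (hfe s hs))
  · exact cs.simple_injective (by rw [hfe a ha, hfe b hb, hab])

theorem doubleCoset_diff_component {i : B}
    (hK : cs.component I i ⊆ {s : B | ∃ t ∈ J, cs.simple s = w * cs.simple t * w⁻¹}) :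
    cs.doubleCoset (I \ cs.component I i) w J = cs.doubleCoset I w J := by
  ext x
  constructor
  · rintro ⟨u, hu, v, hv, rfl⟩
    exact ⟨u, cs.parabolic_mono Set.sdiff_subset hu, v, hv, rfl⟩
  · rintro ⟨u, hu, v, hv, rfl⟩
    induction hu using cs.parabolic_induction with
    | one => exact ⟨1, one_mem _, v, hv, rfl⟩
    | mul s hs u hu ih =>
      obtain ⟨a, ha, b, hb, he⟩ := ih
      rw [mul_assoc, mul_assoc, ← mul_assoc u, he]
      by_cases hsK : s ∈ cs.component I i
      · obtain ⟨t, ht, hst⟩ := hK hsK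
        have hcomm : cs.simple s * a = a * cs.simple s := by
          clear he
          induction ha using cs.parabolic_induction with
          | one => simp
          | mul r hr a _ ih =>
            have hsr : cs.simple s * cs.simple r = cs.simple r * cs.simple s := by
              by_contra hne
              refine hr.2 (Relation.ReflTransGen.tail hsK ⟨hs, hr.1, ?_, hne⟩)
              rintro rfl
              exact hne rfl
            rw [← mul_assoc, hsr, mul_assoc, mul_assoc]
            congr 1
        refine ⟨a, ha, cs.simple t * b, mul_mem (cs.simple_mem_parabolic ht) hb, ?_⟩
        rw [← mul_assoc, ← mul_assoc, hcomm, hst]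
        group
      · exact ⟨cs.simple s * a, mul_mem (cs.simple_mem_parabolic ⟨hs, hsK⟩) ha, b, hb, by group⟩

theorem not_component_subset_of_ncard_le [Finite B]
    (h : ∀ I' J' : Set B, cs.doubleCoset I' w J' = cs.doubleCoset I w J →
      I.ncard + J.ncard ≤ I'.ncard + J'.ncard) {i : B} (hi : i ∈ I) :
    ¬ cs.component I i ⊆ {s : B | ∃ t ∈ J, cs.simple s = w * cs.simple t * w⁻¹} := by
  intro hK
  have h1 := h _ _ (cs.doubleCoset_diff_component hK)
  have h2 : (I \ cs.component I i).ncard < I.ncard :=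
    Set.ncard_lt_ncard (Set.sdiff_ssubset_left_iff.mpr ⟨i, hi, cs.mem_component_self i⟩)
      (Set.toFinite _)
  omega

end Minimal

end CoxeterSystem

/-- A presentation `W_I w W_J` (with `I` left ascents and `J` right ascents of `w`) is
minimal if and only if `|I| + |J|` is minimal among all presentations of the same
double coset with the same `w`. -/
theorem minimal_presentation_iff_card_minimal
    [Fintype B] {M : CoxeterMatrix B} (cs : CoxeterSystem M W)
    (I J : Set B) (w : W)
    (hI : ∀ s ∈ I, cs.length w < cs.length (cs.simple s * w))
    (hJ : ∀ s ∈ J, cs.length w < cs.length (w * cs.simple s)) :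
    cs.IsMinimalPresentation I w J ↔
      ∀ I' J' : Set B, cs.doubleCoset I' w J' = cs.doubleCoset I w J →
        I.ncard + J.ncard ≤ I'.ncard + J'.ncard := by
  constructor
  · intro h I' J' hC
    have h1 := h.ncard_diff_le hC
    have h2 := h.inv.ncard_diff_le (cs.doubleCoset_inv_eq hC)
    have e1 := Set.ncard_inter_add_ncard_sdiff_eq_ncard I I' (Set.toFinite _)
    have e2 := Set.ncard_inter_add_ncard_sdiff_eq_ncard J J' (Set.toFinite _)
    have e3 := Set.ncard_inter_add_ncard_sdiff_eq_ncard I' I (Set.toFinite _)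
    have e4 := Set.ncard_inter_add_ncard_sdiff_eq_ncard J' J (Set.toFinite _)
    rw [Set.inter_comm] at e3 e4
    omega
  · intro h
    refine ⟨hI, hJ, fun i hi => cs.not_component_subset_of_ncard_le h hi, fun j hj => ?_⟩
    have h' : ∀ J' I' : Set B, cs.doubleCoset J' w⁻¹ I' = cs.doubleCoset J w⁻¹ I →
        J.ncard + I.ncard ≤ J'.ncard + I'.ncard := by
      intro J' I' hC
      have := h I' J' (by simpa using cs.doubleCoset_inv_eq hC)
      omega
    simpa using cs.not_component_subset_of_ncard_le h' hj
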